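/- arXiv:2310.11914 — 5 statements merged into one kernel-verified Lean document; each statement's English description precedes it below -/
import Mathlib

section
/- Let γ_1, …, γ_n ∈ (0,1). Let μ_n be the entropic mirror descent iterates on F = KL(·|π) starting from μ_0, i.e. μ_{k+1} has density proportional to μ_k^{1-γ_{k+1}} π^{γ_{k+1}} (equivalently μ_k = μ_{λ_k} with λ_k = 1 − ∏_{i=1}^k (1−γ_i)). If KL(π|μ_0) < ∞ and KL(μ_0|π) < ∞, then KL(μ_n|π) ≤ (C_n/γ_1) · KL(π|μ_0), where C_n^{-1} = Σ_{k=1}^n (γ_k/γ_1) · ∏_{i=1}^k 1/(1−γ_i). -/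
open MeasureTheory Real

/-- The Kullback–Leibler divergence between two probability densities `f` and `g`
with respect to a reference measure `ρ`, `KL(f|g) = ∫ f log(f/g) dρ`. -/
noncomputable def KL {E : Type*} [MeasurableSpace E] (ρ : Measure E) (f g : E → ℝ) : ℝ :=
  ∫ x, f x * Real.log (f x / g x) ∂ρ

/-- `f` is an everywhere-positive probability density with respect to `ρ`. -/
def IsProbDensity {E : Type*} [MeasurableSpace E] (ρ : Measure E) (f : E → ℝ) : Prop :=
  Measurable f ∧ (∀ x, 0 < f x) ∧ ∫ x, f x ∂ρ = 1

namespace IsProbDensity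

variable {E : Type*} [MeasurableSpace E] {ρ : Measure E} {f g m : E → ℝ}

lemma integrable (hf : IsProbDensity ρ f) : Integrable f ρ :=
  .of_integral_ne_zero (by rw [hf.2.2]; exact one_ne_zero)

/-- The Gibbs inequality for positive densities. -/
lemma KL_nonneg (hf : IsProbDensity ρ f) (hg : IsProbDensity ρ g)
    (h : Integrable (fun x => f x * log (f x / g x)) ρ) : 0 ≤ KL ρ f g := by
  have hsub : ∫ x, (f x - g x) ∂ρ = 0 := by
    rw [integral_sub hf.integrable hg.integrable, hf.2.2, hg.2.2, sub_self]
  rw [← hsub]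
  refine integral_mono (hf.integrable.sub hg.integrable) h fun x => ?_
  have hfx := hf.2.1 x
  have hgx := hg.2.1 x
  calc f x - g x = f x * (1 - (f x / g x)⁻¹) := by field_simp
    _ ≤ f x * log (f x / g x) :=
      mul_le_mul_of_nonneg_left (one_sub_inv_le_log_of_pos (div_pos hfx hgx)) hfx.le

/-- If `m ∝ f ^ a * g ^ (1 - a)`, then `m * log (g / f)` is integrable as soon as `KL(f|g)` and
`KL(g|f)` are finite. -/
lemma integrable_mul_log_of_tempered (hf : IsProbDensity ρ f) (hg : IsProbDensity ρ g)
    (hm : IsProbDensity ρ m) {a c : ℝ} (ha0 : 0 ≤ a) (ha1 : a ≤ 1)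
    (hlog : ∀ x, log (m x) = a * log (f x) + (1 - a) * log (g x) - c)
    (hgf : Integrable (fun x => g x * log (g x / f x)) ρ)
    (hfg : Integrable (fun x => f x * log (f x / g x)) ρ) :
    Integrable (fun x => m x * log (g x / f x)) ρ := by
  have hmeas : AEStronglyMeasurable (fun x => m x * log (g x / f x)) ρ :=
    (hm.1.mul (hg.1.div hf.1).log).aestronglyMeasurable
  refine (((hfg.norm.const_mul a).add (hgf.norm.const_mul (1 - a))).const_mul (exp (-c))).mono'
    hmeas (.of_forall fun x => ?_)
  have hfx := hf.2.1 x
  have hgx := hg.2.1 x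
  have hmx := hm.2.1 x
  have hle : m x ≤ exp (-c) * (a * f x + (1 - a) * g x) := by
    have hconv := convexOn_exp.2 (Set.mem_univ (log (f x))) (Set.mem_univ (log (g x))) ha0
      (sub_nonneg.2 ha1) (add_sub_cancel a 1)
    simp only [smul_eq_mul, exp_log hfx, exp_log hgx] at hconv
    rw [← exp_log hmx, hlog, sub_eq_add_neg, add_comm, exp_add]
    gcongr
  have hswap : |log (f x / g x)| = |log (g x / f x)| := by
    rw [← inv_div, log_inv, abs_neg]
  simp only [Pi.add_apply, norm_eq_abs, abs_mul, abs_of_pos hfx, abs_of_pos hgx, abs_of_pos hmx,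
    hswap]
  calc m x * |log (g x / f x)|
      ≤ exp (-c) * (a * f x + (1 - a) * g x) * |log (g x / f x)| := by gcongr
    _ = _ := by ring

/-- If `m ∝ f ^ a * g ^ (1 - a)`, then `(1 - a) KL(m|g) ≤ a KL(g|f)`. -/
lemma KL_tempered_le (hf : IsProbDensity ρ f) (hg : IsProbDensity ρ g)
    (hm : IsProbDensity ρ m) {a c : ℝ} (ha0 : 0 ≤ a) (ha1 : a ≤ 1)
    (hlog : ∀ x, log (m x) = a * log (f x) + (1 - a) * log (g x) - c)
    (hgf : Integrable (fun x => g x * log (g x / f x)) ρ)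
    (hfg : Integrable (fun x => f x * log (f x / g x)) ρ) :
    (1 - a) * KL ρ m g ≤ a * KL ρ g f := by
  have hint := hf.integrable_mul_log_of_tempered hg hm ha0 ha1 hlog hgf hfg
  have hlogdiv {u v : E → ℝ} (hu : IsProbDensity ρ u) (hv : IsProbDensity ρ v) (x : E) :
      log (u x / v x) = log (u x) - log (v x) := log_div (hu.2.1 x).ne' (hv.2.1 x).ne'
  have hmg : (fun x => m x * log (m x / g x)) =
      fun x => -a * (m x * log (g x / f x)) - c * m x := by
    funext x
    rw [hlogdiv hm hg, hlogdiv hg hf, hlog]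
    ring
  have hmf : (fun x => m x * log (m x / f x)) =
      fun x => (1 - a) * (m x * log (g x / f x)) - c * m x := by
    funext x
    rw [hlogdiv hm hf, hlogdiv hg hf, hlog]
    ring
  have hgm : (fun x => g x * log (g x / m x)) =
      fun x => a * (g x * log (g x / f x)) + c * g x := by
    funext x
    rw [hlogdiv hg hm, hlogdiv hg hf, hlog]
    ring
  have hmf_nonneg := hm.KL_nonneg hf
    (by rw [hmf]; exact (hint.const_mul _).sub (hm.integrable.const_mul _))
  have hgm_nonneg := hg.KL_nonneg hm
    (by rw [hgm]; exact (hgf.const_mul _).add (hg.integrable.const_mul _))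
  have hKLmg : KL ρ m g = -a * ∫ x, m x * log (g x / f x) ∂ρ - c := by
    rw [KL, hmg, integral_sub (hint.const_mul _) (hm.integrable.const_mul _),
      integral_const_mul, integral_const_mul, hm.2.2, mul_one]
  have hKLmf : KL ρ m f = (1 - a) * ∫ x, m x * log (g x / f x) ∂ρ - c := by
    rw [KL, hmf, integral_sub (hint.const_mul _) (hm.integrable.const_mul _),
      integral_const_mul, integral_const_mul, hm.2.2, mul_one]
  have hKLgm : KL ρ g m = a * KL ρ g f + c := by
    rw [KL, hgm, integral_add (hgf.const_mul _) (hg.integrable.const_mul _),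
      integral_const_mul, integral_const_mul, hg.2.2, mul_one, KL]
  rw [hKLgm] at hgm_nonneg
  rw [hKLmf] at hmf_nonneg
  rw [hKLmg]
  linarith [mul_nonneg ha0 hmf_nonneg]

end IsProbDensity

/-- The mirror descent iterates are tempered distributions: `μ k ∝ μ 0 ^ a * p ^ (1 - a)` with
`a = ∏ i ∈ Icc 1 k, (1 - γ i)`. -/
lemma exists_log_mirror_descent_eq {E : Type*} {p : E → ℝ} {μ : ℕ → E → ℝ} {γ : ℕ → ℝ} {n : ℕ}
    (hp : ∀ x, 0 < p x) (hμ : ∀ k ≤ n, ∀ x, 0 < μ k x)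
    (hstep : ∀ k, k < n → ∃ Z : ℝ, 0 < Z ∧
      ∀ x, μ (k + 1) x = (μ k x) ^ (1 - γ (k + 1)) * (p x) ^ (γ (k + 1)) / Z)
    {k : ℕ} (hk : k ≤ n) :
    ∃ c : ℝ, ∀ x, log (μ k x) = (∏ i ∈ Finset.Icc 1 k, (1 - γ i)) * log (μ 0 x) +
      (1 - ∏ i ∈ Finset.Icc 1 k, (1 - γ i)) * log (p x) - c := by
  induction k with
  | zero => exact ⟨0, fun x => by simp⟩
  | succ k ih =>
    obtain ⟨c, hc⟩ := ih (by lia)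
    obtain ⟨Z, hZ, hs⟩ := hstep k hk
    refine ⟨(1 - γ (k + 1)) * c + log Z, fun x => ?_⟩
    have hμx := hμ k (by lia) x
    rw [hs, log_div (mul_pos (rpow_pos_of_pos hμx _) (rpow_pos_of_pos (hp x) _)).ne' hZ.ne',
      log_mul (rpow_pos_of_pos hμx _).ne' (rpow_pos_of_pos (hp x) _).ne', log_rpow hμx,
      log_rpow (hp x), hc, Finset.prod_Icc_succ_top (by lia)]
    ring

lemma sum_mul_prod_one_sub_inv {γ : ℕ → ℝ} {n : ℕ} (hγ : ∀ k, 1 ≤ k → k ≤ n → γ k ≠ 1) :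
    ∑ k ∈ Finset.Icc 1 n, γ k * ∏ i ∈ Finset.Icc 1 k, (1 - γ i)⁻¹ =
      (∏ i ∈ Finset.Icc 1 n, (1 - γ i))⁻¹ - 1 := by
  induction n with
  | zero => simp
  | succ n ih =>
    have h : 1 - γ (n + 1) ≠ 0 := sub_ne_zero.2 (hγ (n + 1) (by lia) le_rfl).symm
    rw [Finset.sum_Icc_succ_top (by lia), ih fun k h1 h2 => hγ k h1 (by lia),
      Finset.prod_Icc_succ_top (by lia), Finset.prod_Icc_succ_top (by lia), Finset.prod_inv_distrib,
      mul_inv]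
    linear_combination (-(∏ i ∈ Finset.Icc 1 n, (1 - γ i))⁻¹) * mul_inv_cancel₀ h

/-- Convergence rate of entropic mirror descent on `F = KL(·|π)`:
if `μ_{k+1} ∝ μ_k^{1-γ_{k+1}} π^{γ_{k+1}}` with `γ_k ∈ (0,1)`, and both
`KL(π|μ_0)` and `KL(μ_0|π)` are finite, then
`KL(μ_n|π) ≤ (C_n/γ_1)·KL(π|μ_0)` where
`C_n⁻¹ = Σ_{k=1}^n (γ_k/γ_1)·∏_{i=1}^k (1-γ_i)⁻¹`. -/
theorem entropic_mirror_descent_rate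
    {E : Type*} [MeasurableSpace E] (ρ : Measure E) [SigmaFinite ρ]
    (pi : E → ℝ) (μ : ℕ → E → ℝ) (γ : ℕ → ℝ) (n : ℕ) (hn : 1 ≤ n)
    (hγ : ∀ k, 1 ≤ k → k ≤ n → γ k ∈ Set.Ioo (0 : ℝ) 1)
    (hpi : IsProbDensity ρ pi)
    (hμ : ∀ k, k ≤ n → IsProbDensity ρ (μ k))
    (hstep : ∀ k, k < n → ∃ Z : ℝ, 0 < Z ∧
        ∀ x, μ (k + 1) x = (μ k x) ^ (1 - γ (k + 1)) * (pi x) ^ (γ (k + 1)) / Z)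
    (hKLfwd : Integrable (fun x => pi x * Real.log (pi x / μ 0 x)) ρ)
    (hKLbwd : Integrable (fun x => μ 0 x * Real.log (μ 0 x / pi x)) ρ) :
    KL ρ (μ n) pi ≤
      ((∑ k ∈ Finset.Icc 1 n, (γ k / γ 1) * ∏ i ∈ Finset.Icc 1 k, (1 - γ i)⁻¹)⁻¹ / γ 1) *
        KL ρ pi (μ 0) := by
  obtain ⟨c, hc⟩ := exists_log_mirror_descent_eq hpi.2.1 (fun k hk => (hμ k hk).2.1) hstep le_rfl
  have hpos : ∀ i ∈ Finset.Icc 1 n, 0 < 1 - γ i := fun i hi =>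
    sub_pos.2 (hγ i (Finset.mem_Icc.1 hi).1 (Finset.mem_Icc.1 hi).2).2
  have ha0 : 0 < ∏ i ∈ Finset.Icc 1 n, (1 - γ i) := Finset.prod_pos hpos
  have ha1 : ∏ i ∈ Finset.Icc 1 n, (1 - γ i) < 1 := by
    have hlt : ∀ i ∈ Finset.Icc 1 n, 1 - γ i < 1 := fun i hi =>
      sub_lt_self 1 (hγ i (Finset.mem_Icc.1 hi).1 (Finset.mem_Icc.1 hi).2).1
    have hne : (Finset.Icc 1 n).Nonempty := Finset.nonempty_Icc.2 hn
    simpa using Finset.prod_lt_prod_of_nonempty hpos hlt hne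
  have hle := (hμ 0 n.zero_le).KL_tempered_le hpi (hμ n le_rfl) ha0.le ha1.le hc hKLfwd hKLbwd
  have hγ1 : γ 1 ≠ 0 := (hγ 1 le_rfl hn).1.ne'
  have hsum : ∑ k ∈ Finset.Icc 1 n, (γ k / γ 1) * ∏ i ∈ Finset.Icc 1 k, (1 - γ i)⁻¹ =
      ((∏ i ∈ Finset.Icc 1 n, (1 - γ i))⁻¹ - 1) / γ 1 := by
    rw [← sum_mul_prod_one_sub_inv fun k h1 h2 => (hγ k h1 h2).2.ne, Finset.sum_div]
    exact Finset.sum_congr rfl fun k _ => div_mul_eq_mul_div _ _ _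
  rw [hsum]
  set a := ∏ i ∈ Finset.Icc 1 n, (1 - γ i)
  have ha : 0 < 1 - a := sub_pos.2 ha1
  have hcoef : ((a⁻¹ - 1) / γ 1)⁻¹ / γ 1 = a / (1 - a) := by
    have : a⁻¹ - 1 = (1 - a) / a := by field_simp
    rw [this]
    field_simp
  rw [hcoef, div_mul_eq_mul_div, le_div_iff₀ ha, mul_comm]
  exact hle
end

section
/- Let 0 = λ_0 < λ_1 < λ_2 < … < λ_n < 1 be a tempering schedule and let μ_{λ_k} be the corresponding tempered distributions with density proportional to μ_0^{1−λ_k} π^{λ_k}. If KL(π|μ_0) < ∞ and KL(μ_0|π) < ∞, then KL(μ_{λ_n}|π) ≤ (1/λ_1) · (1 − λ_n) · KL(π|μ_0). -/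
open MeasureTheory Real

/-- Integrated form of `1 + t ≤ exp t` against a nonnegative density `u`. -/
lemma integral_add_integral_mul_le_integral {E : Type*} [MeasurableSpace E] {ρ : Measure E}
    {u t v : E → ℝ} (hu0 : ∀ x, 0 ≤ u x) (hu : Integrable u ρ)
    (hut : Integrable (fun x => u x * t x) ρ) (hv : Integrable v ρ)
    (h : ∀ x, u x * Real.exp (t x) = v x) :
    ∫ x, u x ∂ρ + ∫ x, u x * t x ∂ρ ≤ ∫ x, v x ∂ρ := by
  rw [← integral_add hu hut]
  refine integral_mono (hu.add hut) hv fun x => ?_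
  change u x + u x * t x ≤ v x
  rw [← h x]
  nlinarith [mul_le_mul_of_nonneg_left (Real.add_one_le_exp (t x)) (hu0 x)]

/-- A geometric mixture of two positive numbers is at most their sum. -/
lemma rpow_mul_rpow_le_add {a b l : ℝ} (ha : 0 < a) (hb : 0 < b) (hl0 : 0 ≤ l) (hl1 : l ≤ 1) :
    a ^ (1 - l) * b ^ l ≤ a + b := by
  have h := Real.geom_mean_le_arith_mean2_weighted (sub_nonneg.2 hl1) hl0 ha.le hb.le (by ring)
  nlinarith [mul_nonneg hl0 ha.le, mul_nonneg (sub_nonneg.2 hl1) hb.le]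

/-- A geometric mixture is an exponential tilt of its first endpoint. -/
lemma rpow_mul_rpow_eq_mul_exp_left {a b : ℝ} (ha : 0 < a) (hb : 0 < b) (l : ℝ) :
    a ^ (1 - l) * b ^ l = a * Real.exp (l * Real.log (b / a)) := by
  nth_rewrite 2 [← Real.exp_log ha]
  rw [Real.rpow_def_of_pos ha, Real.rpow_def_of_pos hb, ← Real.exp_add, ← Real.exp_add,
    Real.log_div hb.ne' ha.ne']
  congr 1
  ring

/-- A geometric mixture is an exponential tilt of its second endpoint. -/
lemma rpow_mul_rpow_eq_mul_exp_right {a b : ℝ} (ha : 0 < a) (hb : 0 < b) (l : ℝ) :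
    a ^ (1 - l) * b ^ l = b * Real.exp (-(1 - l) * Real.log (b / a)) := by
  have h := rpow_mul_rpow_eq_mul_exp_left hb ha (1 - l)
  rw [sub_sub_cancel, mul_comm] at h
  rw [h, ← inv_div b a, Real.log_inv, mul_neg, neg_mul]

lemma IsProbDensity.integrable_s2 {E : Type*} [MeasurableSpace E] {ρ : Measure E} {f : E → ℝ}
    (hf : IsProbDensity ρ f) : Integrable f ρ :=
  Integrable.of_integral_ne_zero (by rw [hf.2.2]; exact one_ne_zero)

section GeometricMixture

variable {E : Type*} [MeasurableSpace E] {ρ : Measure E} {μ0 pi : E → ℝ} {l : ℝ}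

/-- The unnormalized geometric mixture of two probability densities is integrable. -/
lemma integrable_rpow_mul_rpow (hμ0 : IsProbDensity ρ μ0) (hpi : IsProbDensity ρ pi)
    (hl0 : 0 ≤ l) (hl1 : l ≤ 1) : Integrable (fun x => μ0 x ^ (1 - l) * pi x ^ l) ρ := by
  have hm := hμ0.1
  have hp := hpi.1
  refine (hμ0.integrable_s2.add hpi.integrable_s2).mono' (by fun_prop) (ae_of_all _ fun x => ?_)
  have h1 := hμ0.2.1 x
  have h2 := hpi.2.1 x
  rw [Real.norm_of_nonneg (by positivity)]
  exact rpow_mul_rpow_le_add h1 h2 hl0 hl1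

/-- The log-likelihood ratio is integrable against the geometric mixture as soon as it is
integrable against both endpoints. -/
lemma integrable_rpow_mul_rpow_mul_log (hμ0 : IsProbDensity ρ μ0) (hpi : IsProbDensity ρ pi)
    (hl0 : 0 ≤ l) (hl1 : l ≤ 1)
    (hfwd : Integrable (fun x => pi x * Real.log (pi x / μ0 x)) ρ)
    (hbwd : Integrable (fun x => μ0 x * Real.log (μ0 x / pi x)) ρ) :
    Integrable (fun x => μ0 x ^ (1 - l) * pi x ^ l * Real.log (pi x / μ0 x)) ρ := by
  have hm := hμ0.1
  have hp := hpi.1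
  refine (hbwd.norm.add hfwd.norm).mono' (by fun_prop) (ae_of_all _ fun x => ?_)
  have h1 := hμ0.2.1 x
  have h2 := hpi.2.1 x
  have hlog : Real.log (μ0 x / pi x) = -Real.log (pi x / μ0 x) := by
    rw [← inv_div, Real.log_inv]
  have hg : 0 ≤ μ0 x ^ (1 - l) * pi x ^ l := by positivity
  simp only [Pi.add_apply, norm_mul, hlog, norm_neg, Real.norm_of_nonneg h1.le,
    Real.norm_of_nonneg h2.le]
  rw [← norm_mul, Real.norm_of_nonneg hg, ← add_mul]
  exact mul_le_mul_of_nonneg_right (rpow_mul_rpow_le_add h1 h2 hl0 hl1) (norm_nonneg _)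

/-- The normalizing constant of the geometric mixture is positive. -/
lemma integral_rpow_mul_rpow_pos (hμ0 : IsProbDensity ρ μ0) (hpi : IsProbDensity ρ pi)
    (hl0 : 0 ≤ l) (hl1 : l ≤ 1) : 0 < ∫ x, μ0 x ^ (1 - l) * pi x ^ l ∂ρ := by
  have hpos : ∀ x, 0 < μ0 x ^ (1 - l) * pi x ^ l := fun x =>
    mul_pos (Real.rpow_pos_of_pos (hμ0.2.1 x) _) (Real.rpow_pos_of_pos (hpi.2.1 x) _)
  rw [integral_pos_iff_support_of_nonneg (fun x => (hpos x).le)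
    (integrable_rpow_mul_rpow hμ0 hpi hl0 hl1),
    Function.support_eq_univ fun x => (hpos x).ne', Measure.measure_univ_pos]
  rintro rfl
  simpa using hpi.2.2

/-- Gibbs' inequality for positive probability densities. -/
lemma KL_nonneg (hμ0 : IsProbDensity ρ μ0) (hpi : IsProbDensity ρ pi)
    (hfwd : Integrable (fun x => pi x * Real.log (pi x / μ0 x)) ρ) : 0 ≤ KL ρ pi μ0 := by
  have h := integral_add_integral_mul_le_integral (t := fun x => -Real.log (pi x / μ0 x))
    (fun x => (hpi.2.1 x).le) hpi.integrable_s2 (by simpa only [mul_neg] using hfwd.fun_neg)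
    hμ0.integrable_s2 fun x => by
      rw [Real.exp_neg, Real.exp_log (div_pos (hpi.2.1 x) (hμ0.2.1 x)), inv_div,
        mul_div_cancel₀ _ (hpi.2.1 x).ne']
  simp only [mul_neg, integral_neg, hμ0.2.2, hpi.2.2] at h
  change 0 ≤ ∫ x, pi x * Real.log (pi x / μ0 x) ∂ρ
  linarith

/-- Jensen's lower bound on the log-normalizing constant of the geometric mixture. -/
lemma neg_mul_KL_le_log_integral (hμ0 : IsProbDensity ρ μ0) (hpi : IsProbDensity ρ pi)
    (hl0 : 0 ≤ l) (hl1 : l ≤ 1)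
    (hfwd : Integrable (fun x => pi x * Real.log (pi x / μ0 x)) ρ) :
    -(1 - l) * KL ρ pi μ0 ≤ Real.log (∫ x, μ0 x ^ (1 - l) * pi x ^ l ∂ρ) := by
  have hZ := integral_rpow_mul_rpow_pos hμ0 hpi hl0 hl1
  have hg := integrable_rpow_mul_rpow hμ0 hpi hl0 hl1
  set Z := ∫ x, μ0 x ^ (1 - l) * pi x ^ l ∂ρ with hZdef
  have hsplit : (fun x => pi x * (-(1 - l) * Real.log (pi x / μ0 x) - Real.log Z)) =
      fun x => -(1 - l) * (pi x * Real.log (pi x / μ0 x)) - Real.log Z * pi x := by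
    funext x
    ring
  have h := integral_add_integral_mul_le_integral
    (t := fun x => -(1 - l) * Real.log (pi x / μ0 x) - Real.log Z)
    (fun x => (hpi.2.1 x).le) hpi.integrable_s2
    (by rw [hsplit]; exact (hfwd.const_mul _).sub (hpi.integrable_s2.const_mul _))
    (hg.div_const Z) fun x => by
      rw [Real.exp_sub, Real.exp_log hZ, ← mul_div_assoc,
        ← rpow_mul_rpow_eq_mul_exp_right (hμ0.2.1 x) (hpi.2.1 x)]
  rw [hsplit, integral_sub (hfwd.const_mul _) (hpi.integrable_s2.const_mul _), integral_const_mul,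
    integral_const_mul, integral_div, ← hZdef, div_self hZ.ne', hpi.2.2] at h
  change -(1 - l) * ∫ x, pi x * Real.log (pi x / μ0 x) ∂ρ ≤ _
  linarith

/-- Nonnegativity of the divergence from the geometric mixture to its first endpoint, written in
terms of the normalizing constant. -/
lemma integral_mul_log_integral_le (hμ0 : IsProbDensity ρ μ0) (hpi : IsProbDensity ρ pi)
    (hl0 : 0 ≤ l) (hl1 : l ≤ 1)
    (hfwd : Integrable (fun x => pi x * Real.log (pi x / μ0 x)) ρ)
    (hbwd : Integrable (fun x => μ0 x * Real.log (μ0 x / pi x)) ρ) :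
    (∫ x, μ0 x ^ (1 - l) * pi x ^ l ∂ρ) * Real.log (∫ x, μ0 x ^ (1 - l) * pi x ^ l ∂ρ) ≤
      l * ∫ x, μ0 x ^ (1 - l) * pi x ^ l * Real.log (pi x / μ0 x) ∂ρ := by
  have hZ := integral_rpow_mul_rpow_pos hμ0 hpi hl0 hl1
  have hg := integrable_rpow_mul_rpow hμ0 hpi hl0 hl1
  have hgL := integrable_rpow_mul_rpow_mul_log hμ0 hpi hl0 hl1 hfwd hbwd
  set Z := ∫ x, μ0 x ^ (1 - l) * pi x ^ l ∂ρ with hZdef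
  have hsplit : (fun x => μ0 x ^ (1 - l) * pi x ^ l *
      (Real.log Z - l * Real.log (pi x / μ0 x))) =
      fun x => Real.log Z * (μ0 x ^ (1 - l) * pi x ^ l) -
        l * (μ0 x ^ (1 - l) * pi x ^ l * Real.log (pi x / μ0 x)) := by
    funext x
    ring
  have h := integral_add_integral_mul_le_integral
    (t := fun x => Real.log Z - l * Real.log (pi x / μ0 x))
    (fun x => mul_nonneg (Real.rpow_nonneg (hμ0.2.1 x).le (1 - l))
      (Real.rpow_nonneg (hpi.2.1 x).le l)) hg
    (by rw [hsplit]; exact (hg.const_mul _).sub (hgL.const_mul _))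
    (hμ0.integrable_s2.const_mul Z) fun x => by
      rw [rpow_mul_rpow_eq_mul_exp_left (hμ0.2.1 x) (hpi.2.1 x), Real.exp_sub, Real.exp_log hZ]
      field_simp
  rw [hsplit, integral_sub (hg.const_mul _) (hgL.const_mul _), integral_const_mul,
    integral_const_mul, integral_const_mul, ← hZdef, hμ0.2.2] at h
  linarith

/-- The divergence from the normalized geometric mixture to its second endpoint. -/
lemma KL_geometric_mixture_eq (hμ0 : IsProbDensity ρ μ0) (hpi : IsProbDensity ρ pi)
    (hl0 : 0 ≤ l) (hl1 : l ≤ 1)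
    (hfwd : Integrable (fun x => pi x * Real.log (pi x / μ0 x)) ρ)
    (hbwd : Integrable (fun x => μ0 x * Real.log (μ0 x / pi x)) ρ)
    {Z : ℝ} (hZ : Z = ∫ x, μ0 x ^ (1 - l) * pi x ^ l ∂ρ) :
    KL ρ (fun x => μ0 x ^ (1 - l) * pi x ^ l / Z) pi =
      -(1 - l) / Z * (∫ x, μ0 x ^ (1 - l) * pi x ^ l * Real.log (pi x / μ0 x) ∂ρ) -
        Real.log Z := by
  have hZpos : 0 < Z := hZ ▸ integral_rpow_mul_rpow_pos hμ0 hpi hl0 hl1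
  have hg := integrable_rpow_mul_rpow hμ0 hpi hl0 hl1
  have hgL := integrable_rpow_mul_rpow_mul_log hμ0 hpi hl0 hl1 hfwd hbwd
  have hsplit : ∀ x, μ0 x ^ (1 - l) * pi x ^ l / Z *
      Real.log (μ0 x ^ (1 - l) * pi x ^ l / Z / pi x) =
      -(1 - l) / Z * (μ0 x ^ (1 - l) * pi x ^ l * Real.log (pi x / μ0 x)) -
        Real.log Z / Z * (μ0 x ^ (1 - l) * pi x ^ l) := fun x => by
    have hlog : Real.log (μ0 x ^ (1 - l) * pi x ^ l / Z / pi x) =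
        -(1 - l) * Real.log (pi x / μ0 x) - Real.log Z := by
      rw [rpow_mul_rpow_eq_mul_exp_right (hμ0.2.1 x) (hpi.2.1 x), div_right_comm,
        mul_div_cancel_left₀ _ (hpi.2.1 x).ne', Real.log_div (Real.exp_ne_zero _) hZpos.ne',
        Real.log_exp]
    rw [hlog]
    ring
  simp only [KL, hsplit]
  rw [integral_sub (hgL.const_mul _) (hg.const_mul _), integral_const_mul, integral_const_mul,
    ← hZ, div_mul_cancel₀ _ hZpos.ne']

/-- The geometric mixture with weight `l` on `pi` is within `(1 - l) / l * KL(pi|μ0)` of `pi`. -/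
lemma KL_geometric_mixture_le (hμ0 : IsProbDensity ρ μ0) (hpi : IsProbDensity ρ pi)
    (hl0 : 0 < l) (hl1 : l ≤ 1)
    (hfwd : Integrable (fun x => pi x * Real.log (pi x / μ0 x)) ρ)
    (hbwd : Integrable (fun x => μ0 x * Real.log (μ0 x / pi x)) ρ)
    {Z : ℝ} (hZ : Z = ∫ x, μ0 x ^ (1 - l) * pi x ^ l ∂ρ) :
    KL ρ (fun x => μ0 x ^ (1 - l) * pi x ^ l / Z) pi ≤ 1 / l * (1 - l) * KL ρ pi μ0 := by
  have hZpos : 0 < Z := hZ ▸ integral_rpow_mul_rpow_pos hμ0 hpi hl0.le hl1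
  have hJensen := neg_mul_KL_le_log_integral hμ0 hpi hl0.le hl1 hfwd
  have hGibbs := integral_mul_log_integral_le hμ0 hpi hl0.le hl1 hfwd hbwd
  rw [KL_geometric_mixture_eq hμ0 hpi hl0.le hl1 hfwd hbwd hZ]
  rw [← hZ] at hJensen hGibbs
  set B := ∫ x, μ0 x ^ (1 - l) * pi x ^ l * Real.log (pi x / μ0 x) ∂ρ
  have hB : Real.log Z / l ≤ B / Z := by
    rw [div_le_div_iff₀ hl0 hZpos]
    linarith
  calc -(1 - l) / Z * B - Real.log Z = -((1 - l) * (B / Z)) - Real.log Z := by ring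
    _ ≤ -((1 - l) * (Real.log Z / l)) - Real.log Z := by
      gcongr
    _ = 1 / l * -Real.log Z := by
      field_simp
      ring
    _ ≤ 1 / l * ((1 - l) * KL ρ pi μ0) := by
      gcongr
      linarith
    _ = 1 / l * (1 - l) * KL ρ pi μ0 := by ring

end GeometricMixture

/-- For a tempering schedule `0 = λ_0 < λ_1 < … < λ_n < 1`, the tempered distributions
`μ_{λ_k} ∝ μ_0^{1-λ_k} π^{λ_k}` satisfy
`KL(μ_{λ_n}|π) ≤ (1/λ_1)·(1-λ_n)·KL(π|μ_0)` when `KL(π|μ_0)` and `KL(μ_0|π)` are finite. -/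
theorem tempering_rate
    {E : Type*} [MeasurableSpace E] (ρ : Measure E) [SigmaFinite ρ]
    (μ0 pi : E → ℝ) (hμ0 : IsProbDensity ρ μ0) (hpi : IsProbDensity ρ pi)
    (Λ : ℕ → ℝ) (n : ℕ) (hn : 1 ≤ n)
    (h0 : Λ 0 = 0) (hmono : ∀ k, k < n → Λ k < Λ (k + 1)) (hlast : Λ n < 1)
    (Z : ℝ → ℝ) (hZ : ∀ l, Z l = ∫ x, μ0 x ^ (1 - l) * pi x ^ l ∂ρ)
    (hKLfwd : Integrable (fun x => pi x * Real.log (pi x / μ0 x)) ρ)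
    (hKLbwd : Integrable (fun x => μ0 x * Real.log (μ0 x / pi x)) ρ) :
    KL ρ (fun x => μ0 x ^ (1 - Λ n) * pi x ^ (Λ n) / Z (Λ n)) pi ≤
      (1 / Λ 1) * (1 - Λ n) * KL ρ pi μ0 := by
  have h1pos : 0 < Λ 1 := h0 ▸ hmono 0 hn
  have h1n : Λ 1 ≤ Λ n := by
    have h : ∀ k, 1 ≤ k → k ≤ n → Λ 1 ≤ Λ k := fun k hk =>
      Nat.le_induction (fun _ => le_rfl)
        (fun m _ ih hm => (ih (by omega)).trans (hmono m hm).le) k hk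
    exact h n hn le_rfl
  refine (KL_geometric_mixture_le hμ0 hpi (h1pos.trans_le h1n) hlast.le hKLfwd hKLbwd
    (hZ _)).trans ?_
  have hKL := KL_nonneg hμ0 hpi hKLfwd
  have hl := sub_nonneg.2 hlast.le
  gcongr
end

section
/- Let ν, μ, π be probability measures with everywhere-positive densities with respect to ρ, with KL(ν|π), KL(μ|π), KL(ν|μ) all finite and log(μ/π) integrable with respect to both ν and μ. Then the Bregman divergence of the functional F = KL(·|π) equals the Bregman divergence of the negative entropy: KL(ν|π) − KL(μ|π) − ∫ log(μ(x)/π(x)) d(ν−μ)(x) = KL(ν|μ). In particular F = KL(·|π) is 1-relatively strongly convex and 1-relatively smooth with respect to the negative entropy, for any target π. -/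
open MeasureTheory Real

/-- The Bregman divergence of the functional `F = KL(·|π)` (whose first variation at `μ` is
`log(μ/π)`) coincides with the Bregman divergence of the negative entropy:
`KL(ν|π) - KL(μ|π) - ⟨log(μ/π), ν - μ⟩ = KL(ν|μ)`; in particular `KL(·|π)` is 1-relatively
strongly convex and 1-relatively smooth with respect to the negative entropy, for any `π`. -/
theorem bregman_divergence_of_KL_is_KL
    {E : Type*} [MeasurableSpace E] (ρ : Measure E) [SigmaFinite ρ]
    (ν μ pi : E → ℝ)
    (hν : IsProbDensity ρ ν) (hμ : IsProbDensity ρ μ) (hpi : IsProbDensity ρ pi)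
    (h1 : Integrable (fun x => ν x * Real.log (ν x / pi x)) ρ)
    (h2 : Integrable (fun x => μ x * Real.log (μ x / pi x)) ρ)
    (h3 : Integrable (fun x => ν x * Real.log (ν x / μ x)) ρ)
    (h4 : Integrable (fun x => Real.log (μ x / pi x) * ν x) ρ)
    (h5 : Integrable (fun x => Real.log (μ x / pi x) * μ x) ρ) :
    KL ρ ν pi - KL ρ μ pi -
        ((∫ x, Real.log (μ x / pi x) * ν x ∂ρ) - ∫ x, Real.log (μ x / pi x) * μ x ∂ρ) =
      KL ρ ν μ := by
  have h_chain : KL ρ ν pi = KL ρ ν μ + ∫ x, Real.log (μ x / pi x) * ν x ∂ρ := by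
    unfold KL
    rw [← integral_add h3 h4]
    refine integral_congr_ae (.of_forall fun x => ?_)
    have hνx := (hν.2.1 x).ne'
    have hμx := (hμ.2.1 x).ne'
    have hpix := (hpi.2.1 x).ne'
    simp only [Real.log_div hνx hpix, Real.log_div hνx hμx, Real.log_div hμx hpix]
    ring
  have h_self : KL ρ μ pi = ∫ x, Real.log (μ x / pi x) * μ x ∂ρ := by
    simp only [KL, mul_comm]
  rw [h_chain, h_self]
  ring
end

section
/- Let s(x) = log(π(x)/μ_0(x)), ψ(λ) = log ∫ μ_0 e^{λ s} dρ, and suppose a < b lie in the interior of {λ : ψ(λ) < ∞} and that λ ↦ I(λ) = Var_{μ_λ}[s(X)] is continuous on [a,b]. Then KL(μ_a|μ_b) = ∫_a^b (b − u)·I(u) du. -/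
open MeasureTheory Real

open ProbabilityTheory

/-- The first-order Taylor expansion of the cumulant-generating function with integral remainder. -/
lemma integral_sub_mul_iteratedDeriv_two_cgf {Ω : Type*} [MeasurableSpace Ω] {P : Measure Ω}
    {X : Ω → ℝ} {a b : ℝ} (ha : a ∈ interior (integrableExpSet X P))
    (hb : b ∈ interior (integrableExpSet X P)) :
    ∫ u in a..b, (b - u) * iteratedDeriv 2 (cgf X P) u =
      cgf X P b - cgf X P a - (b - a) * deriv (cgf X P) a := by
  have hmem : ∀ u ∈ Set.uIcc a b, u ∈ interior (integrableExpSet X P) := fun u hu ↦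
    convex_integrableExpSet.interior.ordConnected.uIcc_subset ha hb hu
  have hderiv : ∀ u ∈ Set.uIcc a b, HasDerivAt
      (fun u ↦ (b - u) * deriv (cgf X P) u + cgf X P u)
      ((b - u) * iteratedDeriv 2 (cgf X P) u) u := by
    intro u hu
    have hcgf := analyticAt_cgf (hmem u hu)
    have h := (((hasDerivAt_id u).const_sub b).mul hcgf.deriv.differentiableAt.hasDerivAt).add
      hcgf.differentiableAt.hasDerivAt
    convert! h using 1
    simp [iteratedDeriv_succ]
  have hcont : ContinuousOn (fun u ↦ (b - u) * iteratedDeriv 2 (cgf X P) u) (Set.uIcc a b) := by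
    refine (continuousOn_const.sub continuousOn_id).mul fun u hu ↦ ?_
    simpa [iteratedDeriv_succ, iteratedDeriv_one] using
      (analyticAt_cgf (hmem u hu)).deriv.deriv.continuousAt.continuousWithinAt
  rw [intervalIntegral.integral_eq_sub_of_hasDerivAt hderiv hcont.intervalIntegrable]
  ring

lemma integral_withDensity_ofReal {E : Type*} [MeasurableSpace E] {ρ : Measure E} {f : E → ℝ}
    (hf : Measurable f) (hpos : ∀ x, 0 ≤ f x) (g : E → ℝ) :
    ∫ x, g x ∂ρ.withDensity (fun x ↦ ENNReal.ofReal (f x)) = ∫ x, f x * g x ∂ρ := by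
  rw [integral_withDensity_eq_integral_toReal_smul hf.ennreal_ofReal (by simp)]
  simp [hpos]

lemma integrable_withDensity_ofReal_iff {E : Type*} [MeasurableSpace E] {ρ : Measure E} {f : E → ℝ}
    (hf : Measurable f) (hpos : ∀ x, 0 ≤ f x) (g : E → ℝ) :
    Integrable g (ρ.withDensity (fun x ↦ ENNReal.ofReal (f x))) ↔
      Integrable (fun x ↦ f x * g x) ρ := by
  rw [integrable_withDensity_iff_integrable_smul' hf.ennreal_ofReal (by simp)]
  simp [hpos]

/-- For `s = log(π/μ_0)`, `ψ(λ) = log ∫ μ_0 e^{λs} dρ`, `a < b` in the interior of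
`{λ : ψ(λ) < ∞}`, and the Fisher information `I(λ) = Var_{μ_λ}[s]` continuous on `[a,b]`,
one has `KL(μ_a|μ_b) = ∫_a^b (b-u)·I(u) du`. -/
theorem KL_along_tempering_path_integral_form
    {E : Type*} [MeasurableSpace E] (ρ : Measure E) [SigmaFinite ρ]
    (μ0 pi : E → ℝ) (hμ0 : IsProbDensity ρ μ0) (hpi : IsProbDensity ρ pi)
    (s : E → ℝ) (hs : ∀ x, s x = Real.log (pi x / μ0 x))
    (ψ m I : ℝ → ℝ)
    (hψ : ∀ l, ψ l = Real.log (∫ x, μ0 x * Real.exp (l * s x) ∂ρ))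
    (hm : ∀ l, m l = ∫ x, s x * (μ0 x * Real.exp (l * s x - ψ l)) ∂ρ)
    (hI : ∀ l, I l = ∫ x, (s x - m l) ^ 2 * (μ0 x * Real.exp (l * s x - ψ l)) ∂ρ)
    (a b : ℝ) (hab : a < b)
    (ha : a ∈ interior {l : ℝ | Integrable (fun x => μ0 x * Real.exp (l * s x)) ρ})
    (hb : b ∈ interior {l : ℝ | Integrable (fun x => μ0 x * Real.exp (l * s x)) ρ})
    (hIcont : ContinuousOn I (Set.Icc a b)) :
    KL ρ (fun x => μ0 x * Real.exp (a * s x - ψ a)) (fun x => μ0 x * Real.exp (b * s x - ψ b)) =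
      ∫ u in a..b, (b - u) * I u := by
  obtain ⟨hmeas, hpos, hone⟩ := hμ0
  set P : Measure E := ρ.withDensity (fun x ↦ ENNReal.ofReal (μ0 x))
  have hint (g : E → ℝ) : ∫ x, g x ∂P = ∫ x, μ0 x * g x ∂ρ :=
    integral_withDensity_ofReal hmeas (fun x ↦ (hpos x).le) g
  have hintble (g : E → ℝ) : Integrable g P ↔ Integrable (fun x ↦ μ0 x * g x) ρ :=
    integrable_withDensity_ofReal_iff hmeas (fun x ↦ (hpos x).le) g
  have hP0 : P ≠ 0 := by
    intro h
    have h1 := hint (fun _ ↦ 1)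
    simp [h, hone] at h1
  have hset : {l : ℝ | Integrable (fun x => μ0 x * Real.exp (l * s x)) ρ} =
      integrableExpSet s P := by
    ext l
    exact (hintble _).symm
  rw [hset] at ha hb
  obtain rfl : ψ = cgf s P := by
    funext l
    rw [hψ, cgf, mgf, hint]
  have hexp {l : ℝ} (hl : l ∈ interior (integrableExpSet s P)) (x : E) :
      exp (l * s x - cgf s P l) = exp (l * s x) / mgf s P l := by
    rw [exp_sub, cgf, exp_log (mgf_pos' hP0 (interior_subset (s := integrableExpSet s P) hl))]
  have htilt {l : ℝ} (hl : l ∈ interior (integrableExpSet s P)) (g : E → ℝ) :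
      ∫ x, g x * (μ0 x * exp (l * s x - cgf s P l)) ∂ρ =
        (∫ x, g x * exp (l * s x) ∂P) / mgf s P l := by
    rw [hint, ← integral_div]
    congr with x
    rw [hexp hl]
    ring
  have hm' {l : ℝ} (hl : l ∈ interior (integrableExpSet s P)) : m l = deriv (cgf s P) l := by
    rw [hm, htilt hl, deriv_cgf hl]
  have hI' {l : ℝ} (hl : l ∈ interior (integrableExpSet s P)) :
      I l = iteratedDeriv 2 (cgf s P) l := by
    rw [hI, htilt hl (fun x ↦ (s x - m l) ^ 2), iteratedDeriv_two_cgf_eq_integral hl, hm' hl]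
  have hlog (x : E) : log (μ0 x * exp (a * s x - cgf s P a) / (μ0 x * exp (b * s x - cgf s P b))) =
      (a - b) * s x + (cgf s P b - cgf s P a) := by
    rw [mul_div_mul_left _ _ (hpos x).ne', ← exp_sub, log_exp]
    ring
  have hKL : KL ρ (fun x => μ0 x * exp (a * s x - cgf s P a))
      (fun x => μ0 x * exp (b * s x - cgf s P b)) =
        cgf s P b - cgf s P a - (b - a) * deriv (cgf s P) a := by
    have hs1 : Integrable (fun x ↦ s x * exp (a * s x)) P := by
      simpa using integrable_pow_mul_exp_of_mem_interior_integrableExpSet ha 1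
    have hs0 : Integrable (fun x ↦ exp (a * s x)) P :=
      interior_subset (s := integrableExpSet s P) ha
    have hmgf : mgf s P a ≠ 0 := (mgf_pos' hP0 hs0).ne'
    simp_rw [KL, hlog, mul_comm _ ((a - b) * _ + _)]
    rw [htilt ha (fun x ↦ (a - b) * s x + (cgf s P b - cgf s P a))]
    simp_rw [add_mul, mul_assoc]
    rw [integral_add (hs1.const_mul _) (hs0.const_mul _), integral_const_mul, integral_const_mul,
      deriv_cgf ha, ← mgf]
    field_simp
    ring
  rw [hKL, ← integral_sub_mul_iteratedDeriv_two_cgf ha hb]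
  refine intervalIntegral.integral_congr fun u hu ↦ ?_
  simp only [hI' (convex_integrableExpSet.interior.ordConnected.uIcc_subset ha hb hu)]
end

section
/- Let 0 ≤ λ_{n−1} < λ_n ≤ 1 and set γ_n = (λ_n − λ_{n−1})/(1 − λ_{n−1}). For positive reals p = π(x) and q = μ_0(x), define the unnormalized tempered density η_{n−1}(x) = q^{1−λ_{n−1}} p^{λ_{n−1}}. Then the SMC importance weight satisfies the exact pointwise identity (p/q)^{λ_n − λ_{n−1}} = (p/η_{n−1}(x))^{γ_n}; i.e., the incremental importance weight w_n(x) = (π(x)/μ_0(x))^{λ_n − λ_{n−1}} of an SMC sampler coincides with (π(x)/η_{n−1}(x))^{γ_n}, the exponential mirror descent update with step size γ_n. -/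
/-- The SMC incremental importance weight coincides with the exponential mirror descent
update: for `0 ≤ λ_{n-1} < λ_n ≤ 1`, `γ_n = (λ_n - λ_{n-1})/(1 - λ_{n-1})`, and positive
reals `p = π(x)`, `q = μ_0(x)` with unnormalized tempered density
`η_{n-1}(x) = q^{1-λ_{n-1}} p^{λ_{n-1}}`, one has the exact pointwise identity
`(p/q)^{λ_n - λ_{n-1}} = (p/η_{n-1}(x))^{γ_n}`. -/
theorem smc_weight_is_mirror_descent_update
    (l1 l2 : ℝ) (h0 : 0 ≤ l1) (h12 : l1 < l2) (h2 : l2 ≤ 1)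
    (p q : ℝ) (hp : 0 < p) (hq : 0 < q) :
    (p / q) ^ (l2 - l1) = (p / (q ^ (1 - l1) * p ^ l1)) ^ ((l2 - l1) / (1 - l1)) := by
  have hne : 1 - l1 ≠ 0 := sub_ne_zero.mpr (h12.trans_le h2).ne'
  have hbase : p / (q ^ (1 - l1) * p ^ l1) = (p / q) ^ (1 - l1) := by
    rw [Real.div_rpow hp.le hq.le, Real.rpow_sub hp, Real.rpow_one, div_div, mul_comm]
  rw [hbase, ← Real.rpow_mul (div_pos hp hq).le, mul_div_cancel₀ _ hne]
end
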